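/- arXiv:2601.05195 — 3 statements merged into one kernel-verified Lean document; each statement's English description precedes it below -/
import Mathlib

section
/- Let G be a finite graph with average degree d = 2|E(G)|/|V(G)| and girth γ (the length of a shortest cycle). Then bn(G) ≥ (1 - 2/d)·γ. -/
variable {V : Type*} [Fintype V] [DecidableEq V]

/-- An F2-cycle relative to an edge set `E`: a finite set of edges, all belonging to `E`,
in which every vertex has even degree. -/
def IsF2CycleIn (E : Set (Sym2 V)) (C : Finset (Sym2 V)) : Prop :=
  (∀ e ∈ C, e ∈ E) ∧ ∀ v : V, Even ((C.filter (fun e => v ∈ e)).card)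

/-- `B` generates the cycle space of the graph with edge set `E`: every F2-cycle is a
symmetric difference of a subfamily of `B`. -/
def GeneratesIn (E : Set (Sym2 V)) (B : List (Finset (Sym2 V))) : Prop :=
  ∀ C : Finset (Sym2 V), IsF2CycleIn E C →
    ∃ l : List (Finset (Sym2 V)), l.Sublist B ∧ C = l.foldr symmDiff ∅

/-- The basis number of the graph with edge set `E`: the least `k` such that some
family of F2-cycles generating the cycle space uses each edge at most `k` times. -/
noncomputable def bnSet (E : Set (Sym2 V)) : ℕ :=
  sInf {k | ∃ B : List (Finset (Sym2 V)), (∀ X ∈ B, IsF2CycleIn E X) ∧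
    GeneratesIn E B ∧ ∀ e : Sym2 V, B.countP (fun X => decide (e ∈ X)) ≤ k}

/-- The basis number of a graph. -/
noncomputable def SimpleGraph.bn (G : SimpleGraph V) : ℕ := bnSet G.edgeSet

open Finset in
lemma even_card_symmDiff_iff {α : Type*} [DecidableEq α] (A B : Finset α) :
    Even #(symmDiff A B) ↔ (Even #A ↔ Even #B) := by
  have hunion : #(symmDiff A B) = #(A \ B) + #(B \ A) :=
    card_union_of_disjoint disjoint_sdiff_sdiff
  have hA := card_sdiff_add_card_inter A B
  have hB := card_sdiff_add_card_inter B A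
  rw [inter_comm] at hB
  grind

/-- A nonempty F2-cycle of `G` has at least `G.girth` edges. -/
lemma SimpleGraph.girth_le_card_of_isF2CycleIn (G : SimpleGraph V) {C : Finset (Sym2 V)}
    (hC : IsF2CycleIn G.edgeSet C) (hne : C.Nonempty) : G.girth ≤ C.card := by
  classical
  let H : SimpleGraph V := SimpleGraph.fromEdgeSet (C : Set (Sym2 V))
  have hdiag : ∀ e ∈ C, ¬ e.IsDiag := fun e he => G.not_isDiag_of_mem_edgeSet (hC.1 e he)
  have hE : H.edgeFinset = C := by
    ext e
    simp only [SimpleGraph.mem_edgeFinset, H, SimpleGraph.edgeSet_fromEdgeSet]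
    simpa using hdiag e
  have hHG : H ≤ G := by
    rw [← SimpleGraph.edgeSet_subset_edgeSet, ← SimpleGraph.coe_edgeFinset, hE]
    exact fun e he => hC.1 e he
  have hdeg (v : V) : Even (H.degree v) := by
    rw [← SimpleGraph.card_incidenceFinset_eq_degree, SimpleGraph.incidenceFinset_eq_filter, hE]
    exact hC.2 v
  have hcyc : ¬ H.IsAcyclic := by
    intro hac
    obtain ⟨e, he⟩ := hne
    induction e with | _ a b
    have hab : H.Adj a b := by
      rw [← SimpleGraph.mem_edgeSet, ← SimpleGraph.mem_edgeFinset, hE]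
      exact he
    have : Nonempty V := ⟨a⟩
    obtain ⟨u, v, p, hp, hmax⟩ := SimpleGraph.Walk.exists_isPath_forall_isPath_length_le_length H
    have hnil : ¬ p.Nil := by
      intro h
      have := hmax _ _ hab.toWalk (by simpa using hab.ne)
      rw [SimpleGraph.Walk.length_eq_zero_iff.mpr h] at this
      simp at this
    have hone : H.degree v = 1 := by
      rw [SimpleGraph.degree_eq_one_iff_existsUnique_adj]
      refine ⟨_, (p.adj_penultimate hnil).symm, fun w hadj ↦ ?_⟩
      apply hac.eq_penultimate_of_adj_end hp hadj
      have : ¬(p.concat hadj).IsPath := by grind [SimpleGraph.Walk.length_concat]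
      grind [hp.concat]
    exact absurd (hdeg v) (by simp [hone])
  obtain ⟨a, w, hw, hlen⟩ := SimpleGraph.exists_girth_eq_length.mpr hcyc
  calc G.girth ≤ H.girth := SimpleGraph.girth_anti hHG hcyc
    _ = w.length := hlen
    _ ≤ H.edgeFinset.card := hw.isCircuit.isTrail.length_le_card_edgeFinset
    _ = C.card := by rw [hE]

/-- The symmetric difference of two edge sets with the same degree parities is an F2-cycle. -/
lemma IsF2CycleIn.symmDiff_of_parity {E : Set (Sym2 V)} {A B : Finset (Sym2 V)}
    (hA : ∀ e ∈ A, e ∈ E) (hB : ∀ e ∈ B, e ∈ E)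
    (h : ∀ v : V, Even ((A.filter (fun e => v ∈ e)).card) ↔
      Even ((B.filter (fun e => v ∈ e)).card)) : IsF2CycleIn E (symmDiff A B) := by
  refine ⟨fun e he => ?_, fun v => ?_⟩
  · rcases Finset.mem_symmDiff.mp he with h | h
    exacts [hA e h.1, hB e h.1]
  · have : (symmDiff A B).filter (fun e => v ∈ e) =
        symmDiff (A.filter (fun e => v ∈ e)) (B.filter (fun e => v ∈ e)) := by
      ext e
      simp only [Finset.mem_filter, Finset.mem_symmDiff]
      tauto
    rw [this, even_card_symmDiff_iff]
    exact h v

open Finset in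
open scoped Classical in
/-- The cycle space has codimension at most `|V|` in the edge space. -/
lemma two_pow_card_le_card_f2Cycles (E : Finset (Sym2 V)) :
    2 ^ #E ≤ #(E.powerset.filter (IsF2CycleIn (E : Set (Sym2 V)))) * 2 ^ Fintype.card V := by
  let par : Finset (Sym2 V) → V → Bool := fun A v => decide (Even #(A.filter (fun e => v ∈ e)))
  have key := card_le_mul_card_image_of_maps_to (f := par) (s := E.powerset)
    (t := univ) (fun _ _ => mem_univ _)
    #(E.powerset.filter (IsF2CycleIn (E : Set (Sym2 V)))) ?_
  · simpa using key
  · intro b _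
    rcases (E.powerset.filter (fun A => par A = b)).eq_empty_or_nonempty with h | ⟨A, hA⟩
    · simp [h]
    · refine card_le_card_of_injOn (fun B => symmDiff A B) ?_ ?_
      · intro B hB
        simp only [coe_filter, mem_filter, mem_powerset, Set.mem_ofPred_eq] at hA hB ⊢
        have hcyc : IsF2CycleIn (E : Set (Sym2 V)) (symmDiff A B) :=
          .symmDiff_of_parity (fun e he => hA.1 he) (fun e he => hB.1 he) fun v => by
            simpa [par] using congrFun (hA.2.trans hB.2.symm) v
        exact ⟨fun e he => hcyc.1 e he, hcyc⟩
      · exact fun B _ B' _ h => symmDiff_right_injective A h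

lemma foldr_symmDiff_filter_ne_empty {α : Type*} [DecidableEq α] (l : List (Finset α)) :
    (l.filter (fun X => decide (X ≠ ∅))).foldr symmDiff ∅ = l.foldr symmDiff ∅ := by
  induction l with
  | nil => rfl
  | cons X l ih =>
    by_cases h : X = ∅
    · subst h
      rw [List.filter_cons_of_neg (by simp), ih, List.foldr_cons]
      exact (bot_symmDiff _).symm
    · rw [List.filter_cons_of_pos (by simpa using h), List.foldr_cons, List.foldr_cons, ih]

/-- A family generating the cycle space has at least `|E| - |V|` nonempty members. -/
lemma GeneratesIn.card_le_length_add {E : Finset (Sym2 V)} {B : List (Finset (Sym2 V))}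
    (hB : GeneratesIn (E : Set (Sym2 V)) B) :
    E.card ≤ (B.filter (fun X => decide (X ≠ ∅))).length + Fintype.card V := by
  classical
  set B' := B.filter (fun X => decide (X ≠ ∅))
  have hsub : E.powerset.filter (IsF2CycleIn (E : Set (Sym2 V))) ⊆
      (B'.sublists.map (List.foldr symmDiff ∅)).toFinset := by
    intro C hC
    obtain ⟨l, hl, rfl⟩ := hB C (Finset.mem_filter.mp hC).2
    simp only [List.mem_toFinset, List.mem_map, List.mem_sublists]
    exact ⟨_, hl.filter _, foldr_symmDiff_filter_ne_empty l⟩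
  have hcard := (Finset.card_le_card hsub).trans (List.toFinset_card_le _)
  rw [List.length_map, List.length_sublists] at hcard
  have := (two_pow_card_le_card_f2Cycles E).trans (Nat.mul_le_mul_right _ hcard)
  rw [← pow_add] at this
  exact (Nat.pow_le_pow_iff_right (by norm_num)).mp this

lemma sum_countP_mem {α : Type*} [DecidableEq α] (E : Finset α) (B : List (Finset α))
    (hB : ∀ X ∈ B, X ⊆ E) :
    ∑ e ∈ E, B.countP (fun X => decide (e ∈ X)) = (B.map Finset.card).sum := by
  induction B with
  | nil => simp
  | cons X B ih =>
    have hX : E.filter (· ∈ X) = X := by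
      rw [Finset.filter_mem_eq_inter, Finset.inter_eq_right.mpr (hB X (by simp))]
    simp only [List.countP_cons, Finset.sum_add_distrib, decide_eq_true_eq,
      ← Finset.card_filter, hX]
    rw [ih fun Y hY => hB Y (by simp [hY]), List.map_cons, List.sum_cons, add_comm]

lemma length_filter_ne_empty_mul_le {α : Type*} [DecidableEq α] (g : ℕ) (B : List (Finset α))
    (hB : ∀ X ∈ B, X.Nonempty → g ≤ X.card) :
    (B.filter (fun X => decide (X ≠ ∅))).length * g ≤ (B.map Finset.card).sum := by
  induction B with
  | nil => simp
  | cons X B ih =>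
    have ih := ih fun Y hY => hB Y (by simp [hY])
    by_cases h : X = ∅
    · simpa [h] using ih
    · have := hB X (by simp) (Finset.nonempty_iff_ne_empty.mpr h)
      rw [List.filter_cons_of_pos (by simpa using h), List.length_cons, List.map_cons,
        List.sum_cons, add_mul, one_mul, add_comm]
      exact add_le_add this ih

/-- The minimum defining the basis number is attained. -/
lemma exists_generatesIn_countP_le_bnSet (E : Set (Sym2 V)) :
    ∃ B : List (Finset (Sym2 V)), (∀ X ∈ B, IsF2CycleIn E X) ∧
      GeneratesIn E B ∧ ∀ e : Sym2 V, B.countP (fun X => decide (e ∈ X)) ≤ bnSet E := by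
  classical
  refine Nat.sInf_mem (s := {k | ∃ B : List (Finset (Sym2 V)), (∀ X ∈ B, IsF2CycleIn E X) ∧
    GeneratesIn E B ∧ ∀ e : Sym2 V, B.countP (fun X => decide (e ∈ X)) ≤ k}) ?_
  let B := (Finset.univ.filter (IsF2CycleIn E)).toList
  refine ⟨B.length, B, by simp [B], fun C hC => ⟨[C], ?_, ?_⟩, fun e => List.countP_le_length⟩
  · simpa [B] using hC
  · exact (symmDiff_bot C).symm

/-- lower bound on the basis number in terms of the average degree
`d = 2|E(G)|/|V(G)|` and the girth `γ`: `bn(G) ≥ (1 - 2/d)·γ`. -/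
theorem bn_lower_bound_girth (G : SimpleGraph V) (γ : ℕ) (hγ : G.girth = (γ : ℕ∞)) :
    (1 - 2 / ((2 * (G.edgeSet.ncard : ℝ)) / (Fintype.card V : ℝ))) * (γ : ℝ) ≤ (G.bn : ℝ) := by
  classical
  obtain rfl : G.girth = γ := by exact_mod_cast hγ
  obtain ⟨B, hcyc, hgen, hcount⟩ := exists_generatesIn_countP_le_bnSet G.edgeSet
  rw [← G.coe_edgeFinset] at hgen
  have hE : G.edgeSet.ncard = G.edgeFinset.card := by
    rw [← G.coe_edgeFinset, Set.ncard_coe_finset]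
  have hlen := hgen.card_le_length_add
  have hlow := length_filter_ne_empty_mul_le G.girth B
    fun X hX hne => G.girth_le_card_of_isF2CycleIn (hcyc X hX) hne
  rw [← sum_countP_mem G.edgeFinset B fun X hX e he =>
    SimpleGraph.mem_edgeFinset.mpr ((hcyc X hX).1 e he)] at hlow
  have hupp := Finset.sum_le_card_nsmul G.edgeFinset _ _ fun e _ => hcount e
  change _ ≤ G.edgeFinset.card • G.bn at hupp
  rw [smul_eq_mul] at hupp
  have hmain : G.edgeFinset.card * G.girth ≤
      G.edgeFinset.card * G.bn + Fintype.card V * G.girth := by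
    nlinarith [Nat.mul_le_mul_right G.girth hlen]
  rw [hE]
  rcases Nat.eq_zero_or_pos G.edgeFinset.card with h0 | hpos
  · have hbot : G = ⊥ := by
      rw [← SimpleGraph.edgeFinset_eq_empty]
      exact Finset.card_eq_zero.mp h0
    have : G.girth = 0 := by
      rw [hbot, SimpleGraph.girth_bot]
    simp [this]
  · have hposR : (0 : ℝ) < G.edgeFinset.card := by exact_mod_cast hpos
    have hmainR : (G.edgeFinset.card : ℝ) * G.girth ≤
      G.edgeFinset.card * G.bn + Fintype.card V * G.girth := by exact_mod_cast hmain
    rw [div_div_eq_mul_div, mul_div_mul_left _ _ two_ne_zero, one_sub_div hposR.ne',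
      div_mul_eq_mul_div, div_le_iff₀ hposR]
    linarith
end

section
/- Let C be a monotone class of graphs (closed under subgraphs). If there is a constant b such that every graph in C has basis number at most b, then there exists a graph H such that no graph in C contains H as a minor. -/
variable {V : Type*} [Fintype V] [DecidableEq V]

/-- `H` is isomorphic to a subgraph of `G`. -/
def IsSubgraphOf {W V : Type*} (H : SimpleGraph W) (G : SimpleGraph V) : Prop :=
  ∃ f : W → V, Function.Injective f ∧ ∀ a b, H.Adj a b → G.Adj (f a) (f b)

/-- `H` is a minor of `G`: there are nonempty, connected, pairwise disjoint branch sets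
in `G`, one for each vertex of `H`, with an edge of `G` between the branch sets of any
two adjacent vertices of `H`. -/
def IsMinorOf {W V : Type*} (H : SimpleGraph W) (G : SimpleGraph V) : Prop :=
  ∃ B : W → Set V,
    (∀ w, (B w).Nonempty ∧ (G.induce (B w)).Connected) ∧
    (Pairwise fun w w' => Disjoint (B w) (B w')) ∧
    ∀ w w', H.Adj w w' → ∃ x ∈ B w, ∃ y ∈ B w', G.Adj x y

/-- Sums over a symmetric difference are additive in characteristic two. -/
theorem Finset.sum_symmDiff_zmod_two {α : Type*} [DecidableEq α] (f : α → ZMod 2)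
    (X Y : Finset α) : ∑ e ∈ symmDiff X Y, f e = ∑ e ∈ X, f e + ∑ e ∈ Y, f e := by
  have h1 := Finset.sum_inter_add_sum_sdiff X Y f
  have h2 := Finset.sum_inter_add_sum_sdiff Y X f
  rw [Finset.inter_comm] at h2
  have h3 : symmDiff X Y = (X \ Y) ∪ (Y \ X) := rfl
  rw [h3, Finset.sum_union (by
    rw [Finset.disjoint_left]; intro a ha hb; simp at ha hb; tauto), ← h1, ← h2]
  linear_combination (-1 : ZMod 2) * CharTwo.add_self_eq_zero (∑ e ∈ X ∩ Y, f e)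

/-- The mod-two degree vector of an edge set. -/
def boundary (X : Finset (Sym2 V)) (v : V) : ZMod 2 := ∑ e ∈ X, if v ∈ e then 1 else 0

theorem boundary_symmDiff {U : Type*} [DecidableEq U] (X Y : Finset (Sym2 U)) :
    boundary (symmDiff X Y) = boundary X + boundary Y := by
  ext v
  exact Finset.sum_symmDiff_zmod_two _ X Y

theorem isF2CycleIn_iff_boundary {U : Type*} [DecidableEq U] (E : Set (Sym2 U))
    (X : Finset (Sym2 U)) :
    IsF2CycleIn E X ↔ (∀ e ∈ X, e ∈ E) ∧ boundary X = 0 := by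
  simp [IsF2CycleIn, funext_iff, boundary, Finset.sum_boole, ZMod.natCast_eq_zero_iff_even]

theorem boundary_erase {U : Type*} [DecidableEq U] {X : Finset (Sym2 U)} {e : Sym2 U}
    (he : e ∈ X) (v : U) :
    boundary (X.erase e) v = boundary X v + if v ∈ e then 1 else 0 := by
  rw [boundary, boundary, ← Finset.add_sum_erase X _ he]
  linear_combination (-1 : ZMod 2) * CharTwo.add_self_eq_zero (if v ∈ e then (1 : ZMod 2) else 0)

/-- The optimal family attains `bnSet`. -/
theorem exists_generating_of_bnSet_le {E : Set (Sym2 V)} {b : ℕ} (h : bnSet E ≤ b) :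
    ∃ B : List (Finset (Sym2 V)), (∀ X ∈ B, IsF2CycleIn E X) ∧
      GeneratesIn E B ∧ ∀ e : Sym2 V, B.countP (fun X => decide (e ∈ X)) ≤ b := by
  classical
  have hne : {k | ∃ B : List (Finset (Sym2 V)), (∀ X ∈ B, IsF2CycleIn E X) ∧
      GeneratesIn E B ∧ ∀ e : Sym2 V, B.countP (fun X => decide (e ∈ X)) ≤ k}.Nonempty := by
    refine ⟨_, (Finset.univ.filter (IsF2CycleIn E)).toList, by simp, fun C hC => ⟨[C], ?_, ?_⟩,
      fun e => List.countP_le_length⟩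
    · simpa using hC
    · ext; simp [Finset.mem_symmDiff]
  obtain ⟨B, h1, h2, h3⟩ := Nat.sInf_mem hne
  exact ⟨B, h1, h2, fun e => (h3 e).trans h⟩

open Classical in
/-- The vertices reachable from `u` in at most `k` steps. -/
noncomputable def stepBall (G : SimpleGraph V) : ℕ → V → Finset V
  | 0, u => {u}
  | k + 1, u => insert u ((G.neighborFinset u).biUnion (stepBall G k))

theorem mem_stepBall_self (G : SimpleGraph V) (k : ℕ) (u : V) : u ∈ stepBall G k u := by
  cases k <;> simp [stepBall]

open Classical in
theorem card_stepBall_le {G : SimpleGraph V} (hG : ∀ v, G.degree v ≤ 3) (k : ℕ) (u : V) :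
    (stepBall G k u).card ≤ 4 ^ k := by
  induction k generalizing u with
  | zero => simp [stepBall]
  | succ k ih =>
    have h1 : ((G.neighborFinset u).biUnion (stepBall G k)).card ≤ 3 * 4 ^ k :=
      (Finset.card_biUnion_le_card_mul _ _ _ fun a _ => ih a).trans
        (Nat.mul_le_mul_right _ (hG u))
    have h2 := Finset.card_insert_le u ((G.neighborFinset u).biUnion (stepBall G k))
    have h3 : 0 < 4 ^ k := by positivity
    rw [stepBall, pow_succ]
    omega

/-- An edge set whose odd vertices are exactly `u` and `v` joins `u` to `v`. -/
theorem mem_stepBall_of_boundary {G : SimpleGraph V} (k : ℕ) {u v : V} (huv : u ≠ v)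
    {F : Finset (Sym2 V)} (hF : ∀ e ∈ F, e ∈ G.edgeSet) (hk : F.card ≤ k)
    (hb : ∀ x, boundary F x = if x ∈ s(u, v) then 1 else 0) : v ∈ stepBall G k u := by
  classical
  have hex : ∀ (F : Finset (Sym2 V)) (u : V), boundary F u = 1 → ∃ e ∈ F, u ∈ e := by
    intro F u h
    by_contra! hcon
    rw [boundary, Finset.sum_congr rfl fun e he => if_neg (hcon e he)] at h
    simp at h
  induction k generalizing u F with
  | zero =>
    obtain rfl : F = ∅ := by simpa using hk
    obtain ⟨e, he, -⟩ := hex ∅ u (by simp [hb])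
    simp at he
  | succ k ih =>
    obtain ⟨e, he, hu⟩ := hex F u (by simp [hb])
    obtain ⟨a, rfl⟩ := hu
    have hadj : G.Adj u a := hF _ he
    have hua : u ≠ a := hadj.ne
    simp only [stepBall, Finset.mem_insert, Finset.mem_biUnion, SimpleGraph.mem_neighborFinset]
    refine Or.inr ⟨a, hadj, ?_⟩
    by_cases hav : a = v
    · exact hav ▸ mem_stepBall_self G k a
    refine ih hav (F := F.erase s(u, a)) (fun e h => hF e (Finset.mem_of_mem_erase h)) ?_ ?_
    · rw [Finset.card_erase_of_mem he]; omega
    · intro x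
      rw [boundary_erase he, hb]
      simp only [Sym2.mem_iff]
      by_cases h1 : x = u
      · subst h1
        simp [hua, huv, CharTwo.add_self_eq_zero]
      · by_cases h2 : x = a
        · subst h2; simp [h1, hav]
        · simp [h1, h2]

open Classical in
/-- Graphs of large girth with average degree bounded away from two. -/
theorem exists_sparse_large_girth {γ : ℕ} (hγ : γ ≠ 0) :
    ∃ H : SimpleGraph (Fin (4 * 4 ^ γ)),
      (∀ Z, IsF2CycleIn H.edgeSet Z → Z.Nonempty → γ ≤ Z.card) ∧
      9 * 4 ^ γ ≤ 2 * H.edgeFinset.card ∧ H.edgeFinset.card ≤ 6 * 4 ^ γ := by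
  set N := 4 ^ γ with hN
  let S : Set (SimpleGraph (Fin (4 * N))) := {H | (∀ v, H.degree v ≤ 3) ∧
    ∀ Z, IsF2CycleIn H.edgeSet Z → Z.Nonempty → γ ≤ Z.card}
  have hS : S.Nonempty := by
    refine ⟨⊥, fun v => by simp, fun Z hZ ⟨e, he⟩ => ?_⟩
    simpa using hZ.1 e he
  obtain ⟨H, hH, hmax⟩ := S.toFinite.exists_maximal hS
  have hclose : ∀ u v, u ≠ v → H.degree u < 3 → H.degree v < 3 → v ∈ stepBall H γ u := by
    intro u v huv hu hv
    by_contra hball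
    have hnadj : ¬ H.Adj u v := by
      intro hadj
      apply hball
      obtain ⟨k, rfl⟩ := Nat.exists_eq_succ_of_ne_zero hγ
      simp only [stepBall, Finset.mem_insert, Finset.mem_biUnion, SimpleGraph.mem_neighborFinset]
      exact Or.inr ⟨v, hadj, mem_stepBall_self _ _ _⟩
    have hedge : (H ⊔ SimpleGraph.edge u v).edgeSet = insert s(u, v) H.edgeSet := by
      rw [SimpleGraph.edgeSet_sup, SimpleGraph.edgeSet_edge_of_ne huv]
      ext; simp
    have hmem : H ⊔ SimpleGraph.edge u v ∈ S := by
      refine ⟨fun x => ?_, fun Z hZ hne => ?_⟩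
      · rw [← SimpleGraph.card_neighborFinset_eq_degree]
        by_cases hxu : x = u
        · subst hxu
          refine (Finset.card_le_card (t := insert v (H.neighborFinset x)) fun y => ?_).trans
            ((Finset.card_insert_le _ _).trans (by simpa using hu))
          simp only [SimpleGraph.mem_neighborFinset, SimpleGraph.sup_adj, SimpleGraph.edge_adj,
            Finset.mem_insert]
          grind
        · by_cases hxv : x = v
          · subst hxv
            refine (Finset.card_le_card (t := insert u (H.neighborFinset x)) fun y => ?_).trans
              ((Finset.card_insert_le _ _).trans (by simpa using hv))
            simp only [SimpleGraph.mem_neighborFinset, SimpleGraph.sup_adj, SimpleGraph.edge_adj,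
              Finset.mem_insert]
            grind
          · refine (Finset.card_le_card (t := H.neighborFinset x) fun y => ?_).trans
              (by simpa using hH.1 x)
            simp only [SimpleGraph.mem_neighborFinset, SimpleGraph.sup_adj, SimpleGraph.edge_adj]
            grind
      · by_contra! hlt
        rw [isF2CycleIn_iff_boundary, hedge] at hZ
        by_cases huvZ : s(u, v) ∈ Z
        · refine hball (mem_stepBall_of_boundary γ huv (F := Z.erase s(u, v)) ?_ ?_ ?_)
          · intro e he
            rw [Finset.mem_erase] at he
            exact (hZ.1 e he.2).resolve_left he.1
          · exact (Finset.card_erase_le).trans hlt.le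
          · intro x
            rw [boundary_erase huvZ, hZ.2]
            simp
        · refine absurd (hH.2 Z ?_ hne) (not_le.2 hlt)
          rw [isF2CycleIn_iff_boundary]
          exact ⟨fun e he => (hZ.1 e he).resolve_left (by rintro rfl; exact huvZ he), hZ.2⟩
    have hle := hmax hmem le_sup_left
    exact hnadj (hle (Or.inr (by simp [SimpleGraph.edge_adj, huv])))
  have hlow : (Finset.univ.filter fun v => H.degree v < 3).card ≤ N := by
    rcases (Finset.univ.filter fun v => H.degree v < 3).eq_empty_or_nonempty with h | ⟨u, hu⟩
    · simp [h]
    · refine (Finset.card_le_card fun v hv => ?_).trans (card_stepBall_le hH.1 γ u)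
      by_cases huv : u = v
      · exact huv ▸ mem_stepBall_self H γ u
      · exact hclose u v huv (by simpa using hu) (by simpa using hv)
  have hsum := H.sum_degrees_eq_twice_card_edges
  have hle : ∑ v, H.degree v ≤ 3 * (4 * N) := by
    simpa [mul_comm] using Finset.sum_le_card_nsmul Finset.univ (fun v => H.degree v) 3
      fun v _ => hH.1 v
  have hge : 3 * (4 * N) ≤ ∑ v, H.degree v +
      3 * (Finset.univ.filter fun v => H.degree v < 3).card := by
    have : ∀ v, 3 ≤ H.degree v + 3 * if H.degree v < 3 then 1 else 0 := by
      intro v; split_ifs <;> omega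
    have := Finset.sum_le_sum fun v (_ : v ∈ Finset.univ) => this v
    rw [Finset.sum_add_distrib, ← Finset.mul_sum] at this
    simpa [mul_comm] using this
  refine ⟨H, hH.2, by omega, by omega⟩

/-- A model of `H` as a minor of `G` with one chosen cross edge for every edge of `H`. -/
structure MinorModel {W V : Type*} (H : SimpleGraph W) (G : SimpleGraph V) where
  branch : W → Set V
  connected : ∀ w, (G.induce (branch w)).Connected
  disjoint : Pairwise fun w w' => Disjoint (branch w) (branch w')
  cross : H.edgeSet → Sym2 V
  cross_mem : ∀ e, cross e ∈ G.edgeSet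
  cross_spec : ∀ e, ∃ w w' x y, e.1 = s(w, w') ∧ w ≠ w' ∧ x ∈ branch w ∧ y ∈ branch w' ∧
    cross e = s(x, y)

theorem IsMinorOf.nonempty_minorModel {W V : Type*} {H : SimpleGraph W} {G : SimpleGraph V}
    (h : IsMinorOf H G) : Nonempty (MinorModel H G) := by
  obtain ⟨B, hB, hd, hadj⟩ := h
  have key : ∀ e : H.edgeSet, ∃ c : Sym2 V, c ∈ G.edgeSet ∧
      ∃ w w' x y, e.1 = s(w, w') ∧ w ≠ w' ∧ x ∈ B w ∧ y ∈ B w' ∧ c = s(x, y) := by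
    rintro ⟨e, he⟩
    induction e using Sym2.ind with
    | _ w w' =>
      obtain ⟨x, hx, y, hy, hxy⟩ := hadj w w' he
      exact ⟨s(x, y), hxy, w, w', x, y, rfl, H.ne_of_adj he, hx, hy, rfl⟩
  choose c hc hc' using key
  exact ⟨⟨B, fun w => (hB w).2, hd, c, hc, hc'⟩⟩

open scoped Classical in
/-- The mod-two incidence map of a graph, sending an edge set to its degree vector. -/
noncomputable def incidenceMap {W : Type*} [Fintype W] (H : SimpleGraph W) :
    (H.edgeSet → ZMod 2) →ₗ[ZMod 2] (W → ZMod 2) where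
  toFun z w := ∑ e : H.edgeSet, if w ∈ e.1 then z e else 0
  map_add' z z' := by
    ext w
    simp only [Pi.add_apply, ← Finset.sum_add_distrib]
    exact Finset.sum_congr rfl fun e _ => by split_ifs <;> simp
  map_smul' c z := by
    ext w
    simp [Finset.mul_sum]

theorem sum_mem_pair {U : Type*} [DecidableEq U] (A : Finset U) {x y : U} (hxy : x ≠ y) :
    (∑ v ∈ A, if v ∈ s(x, y) then (1 : ZMod 2) else 0) =
      (if x ∈ A then 1 else 0) + if y ∈ A then 1 else 0 := by
  have : ∀ v, (if v ∈ s(x, y) then (1 : ZMod 2) else 0) =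
      (if x = v then 1 else 0) + if y = v then 1 else 0 := by
    intro v; simp only [Sym2.mem_iff]; grind
  simp only [this, Finset.sum_add_distrib, Finset.sum_ite_eq]

theorem add_self_eq_zero_of_zmod_two {U : Type*} (f : U → ZMod 2) : f + f = 0 :=
  funext fun _ => CharTwo.add_self_eq_zero _

theorem boundary_edge {U : Type*} [DecidableEq U] {x y : U} (hxy : x ≠ y) :
    boundary {s(x, y)} = Pi.single x 1 + Pi.single y 1 := by
  ext v
  simp only [boundary, Finset.sum_singleton, Sym2.mem_iff, Pi.add_apply, Pi.single_apply]
  grind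

namespace MinorModel

set_option linter.unusedSectionVars false

variable {W : Type*} {H : SimpleGraph W} {G : SimpleGraph V}

/-- The edges of `G` lying within a branch set. -/
def inner (M : MinorModel H G) : Set (Sym2 V) :=
  {e ∈ G.edgeSet | ∃ w, ∀ v ∈ e, v ∈ M.branch w}

/-- The subgraph of `G` made of the inner edges and the chosen cross edges. -/
def support (M : MinorModel H G) : SimpleGraph V :=
  SimpleGraph.fromEdgeSet (M.inner ∪ Set.range M.cross)

theorem union_subset_edgeSet (M : MinorModel H G) :
    M.inner ∪ Set.range M.cross ⊆ G.edgeSet := by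
  rintro e (he | ⟨e, rfl⟩)
  exacts [he.1, M.cross_mem e]

theorem edgeSet_support (M : MinorModel H G) :
    M.support.edgeSet = M.inner ∪ Set.range M.cross := by
  rw [support, SimpleGraph.edgeSet_fromEdgeSet, sdiff_eq_left, Set.disjoint_left]
  exact fun e he => G.not_isDiag_of_mem_edgeSet (M.union_subset_edgeSet he)

theorem support_le (M : MinorModel H G) : M.support ≤ G := by
  rw [← SimpleGraph.edgeSet_subset_edgeSet, edgeSet_support]
  exact M.union_subset_edgeSet

theorem eq_of_mem_branch (M : MinorModel H G) {w w' : W} {v : V} (h : v ∈ M.branch w)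
    (h' : v ∈ M.branch w') : w = w' := by
  by_contra hne
  exact Set.disjoint_left.1 (M.disjoint hne) h h'

theorem cross_notMem_inner (M : MinorModel H G) (e : H.edgeSet) : M.cross e ∉ M.inner := by
  rintro ⟨-, w, hw⟩
  obtain ⟨w₁, w₂, x, y, -, hne, hx, hy, hxy⟩ := M.cross_spec e
  rw [hxy] at hw
  exact hne ((M.eq_of_mem_branch hx (hw x (by simp))).trans
    (M.eq_of_mem_branch (hw y (by simp)) hy))

open scoped Classical in
theorem sum_ends_of_mem_inner (M : MinorModel H G) {e : Sym2 V} (he : e ∈ M.inner) (w : W) :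
    (∑ v with v ∈ M.branch w, if v ∈ e then (1 : ZMod 2) else 0) = 0 := by
  obtain ⟨hG, w', hw'⟩ := he
  induction e using Sym2.ind with
  | _ x y =>
    have hx := hw' x (by simp)
    have hy := hw' y (by simp)
    rw [sum_mem_pair _ (G.ne_of_adj hG)]
    by_cases hw : w = w'
    · subst hw
      simp [hx, hy, CharTwo.add_self_eq_zero]
    · have hx' : x ∉ M.branch w := fun h => hw (M.eq_of_mem_branch h hx)
      have hy' : y ∉ M.branch w := fun h => hw (M.eq_of_mem_branch h hy)
      simp [hx', hy']

open scoped Classical in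
theorem sum_ends_cross (M : MinorModel H G) (e : H.edgeSet) (w : W) :
    (∑ v with v ∈ M.branch w, if v ∈ M.cross e then (1 : ZMod 2) else 0) =
      if w ∈ e.1 then 1 else 0 := by
  obtain ⟨w₁, w₂, x, y, he, hne, hx, hy, hxy⟩ := M.cross_spec e
  have hG := M.cross_mem e
  rw [hxy] at hG ⊢
  rw [sum_mem_pair _ (G.ne_of_adj hG), he]
  have hx' : x ∈ M.branch w ↔ w = w₁ :=
    ⟨fun h => M.eq_of_mem_branch h hx, fun h => h ▸ hx⟩
  have hy' : y ∈ M.branch w ↔ w = w₂ :=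
    ⟨fun h => M.eq_of_mem_branch h hy, fun h => h ▸ hy⟩
  simp only [Finset.mem_filter, Finset.mem_univ, true_and, hx', hy', Sym2.mem_iff]
  grind

theorem cross_injective (M : MinorModel H G) : Function.Injective M.cross := by
  classical
  intro e e' h
  refine Subtype.ext (Sym2.ext fun w => ?_)
  have := M.sum_ends_cross e w
  rw [h, M.sum_ends_cross e' w] at this
  by_cases h1 : w ∈ e.1 <;> by_cases h2 : w ∈ e'.1 <;> simp_all

/-- The edges of `H` whose cross edges belong to `X`, as a mod-two vector. -/
def trace (M : MinorModel H G) (X : Finset (Sym2 V)) (e : H.edgeSet) : ZMod 2 :=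
  if M.cross e ∈ X then 1 else 0

theorem trace_symmDiff (M : MinorModel H G) (X Y : Finset (Sym2 V)) :
    M.trace (symmDiff X Y) = M.trace X + M.trace Y := by
  ext e
  by_cases h1 : M.cross e ∈ X <;> by_cases h2 : M.cross e ∈ Y <;>
    simp [trace, Finset.mem_symmDiff, h1, h2, CharTwo.add_self_eq_zero]

variable [Fintype W]

open scoped Classical in
theorem sum_boundary (M : MinorModel H G) {X : Finset (Sym2 V)}
    (hX : ∀ e ∈ X, e ∈ M.support.edgeSet) (w : W) :
    ∑ v with v ∈ M.branch w, boundary X v = incidenceMap H (M.trace X) w := by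
  let ends (e : Sym2 V) : ZMod 2 := ∑ v with v ∈ M.branch w, if v ∈ e then 1 else 0
  have h1 : ∑ v with v ∈ M.branch w, boundary X v = ∑ e ∈ X, ends e := Finset.sum_comm
  have h2 : ∑ e ∈ Finset.univ.image M.cross, (if e ∈ X then ends e else 0) = ∑ e ∈ X, ends e := by
    rw [← Finset.sum_filter]
    refine Finset.sum_subset (fun e he => (Finset.mem_filter.1 he).2) fun e he hne => ?_
    have hmem := hX e he
    rw [edgeSet_support] at hmem
    refine M.sum_ends_of_mem_inner (hmem.resolve_right ?_) w
    rintro ⟨e', rfl⟩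
    exact hne (by simp [he])
  rw [h1, ← h2, Finset.sum_image fun _ _ _ _ h => M.cross_injective h]
  refine Finset.sum_congr rfl fun e _ => ?_
  simp only [ends, M.sum_ends_cross e w, trace]
  split_ifs <;> rfl

/-- The degree vectors of sets of inner edges. -/
def innerBoundaries (M : MinorModel H G) : AddSubgroup (V → ZMod 2) where
  carrier := {f | ∃ Y : Finset (Sym2 V), (∀ e ∈ Y, e ∈ M.inner) ∧ boundary Y = f}
  zero_mem' := ⟨∅, by simp, by ext; simp [boundary]⟩
  add_mem' := by
    rintro _ _ ⟨Y, hY, rfl⟩ ⟨Z, hZ, rfl⟩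
    refine ⟨symmDiff Y Z, fun e he => ?_, boundary_symmDiff Y Z⟩
    rcases Finset.mem_symmDiff.1 he with h | h
    exacts [hY e h.1, hZ e h.1]
  neg_mem' := by
    rintro _ ⟨Y, hY, rfl⟩
    exact ⟨Y, hY, by ext; simp [CharTwo.neg_eq]⟩

theorem single_add_single_mem (M : MinorModel H G) {w : W} {u v : V} (hu : u ∈ M.branch w)
    (hv : v ∈ M.branch w) : Pi.single u 1 + Pi.single v 1 ∈ M.innerBoundaries := by
  obtain ⟨p⟩ := (M.connected w).preconnected ⟨u, hu⟩ ⟨v, hv⟩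
  have key : ∀ {a c : M.branch w} (p : (G.induce (M.branch w)).Walk a c),
      (Pi.single a.1 1 + Pi.single c.1 1 : V → ZMod 2) ∈ M.innerBoundaries := by
    intro a c p
    induction p with
    | nil => rw [add_self_eq_zero_of_zmod_two]; exact zero_mem _
    | @cons a d c h p ih =>
      have hG : G.Adj a.1 d.1 := h
      have hedge : (Pi.single a.1 1 + Pi.single d.1 1 : V → ZMod 2) ∈ M.innerBoundaries := by
        refine ⟨{s(a.1, d.1)}, fun e he => ?_, boundary_edge hG.ne⟩
        rw [Finset.mem_singleton.1 he]
        refine ⟨hG, w, fun x hx => ?_⟩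
        rcases Sym2.mem_iff.1 hx with rfl | rfl
        exacts [a.2, d.2]
      convert add_mem hedge ih using 1
      linear_combination (-1 : V → ZMod 2) *
        add_self_eq_zero_of_zmod_two (Pi.single d.1 1 : V → ZMod 2)
  exact key p

open scoped Classical in
theorem mem_innerBoundaries (M : MinorModel H G) {f : V → ZMod 2}
    (hout : ∀ v, (∀ w, v ∉ M.branch w) → f v = 0)
    (hsum : ∀ w, ∑ v with v ∈ M.branch w, f v = 0) : f ∈ M.innerBoundaries := by
  have hroot : ∀ w, ∃ r, r ∈ M.branch w := fun w =>
    let ⟨r⟩ := (M.connected w).nonempty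
    ⟨r.1, r.2⟩
  choose r hr using hroot
  have hf : f = ∑ w, ∑ v with v ∈ M.branch w,
      f v • (Pi.single v 1 + Pi.single (r w) 1 : V → ZMod 2) := by
    have h1 : ∀ w, ∑ v with v ∈ M.branch w,
        f v • (Pi.single v 1 + Pi.single (r w) 1 : V → ZMod 2) =
        ∑ v with v ∈ M.branch w, f v • (Pi.single v 1 : V → ZMod 2) := by
      intro w
      simp only [smul_add, Finset.sum_add_distrib, ← Finset.sum_smul, hsum, zero_smul, add_zero]
    ext x
    simp only [h1, Finset.sum_apply, Pi.smul_apply, Pi.single_apply, smul_eq_mul, mul_ite,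
      mul_one, mul_zero, Finset.sum_ite_eq, Finset.mem_filter, Finset.mem_univ, true_and]
    by_cases hx : ∃ w, x ∈ M.branch w
    · obtain ⟨w, hw⟩ := hx
      rw [Finset.sum_eq_single w, if_pos hw]
      · exact fun w' _ hne => if_neg fun h => hne (M.eq_of_mem_branch h hw)
      · simp
    · push Not at hx
      simp [hx, hout x hx]
  rw [hf]
  refine sum_mem fun w _ => sum_mem fun v hv => ZMod.smul_mem ?_ _
  exact M.single_add_single_mem (Finset.mem_filter.1 hv).2 (hr w)

/-- Every cycle of `H` is the trace of a cycle of the supporting subgraph. -/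
theorem exists_lift (M : MinorModel H G) {z : H.edgeSet → ZMod 2} (hz : incidenceMap H z = 0) :
    ∃ X, IsF2CycleIn M.support.edgeSet X ∧ M.trace X = z := by
  classical
  let X₀ : Finset (Sym2 V) := (Finset.univ.filter fun e => z e ≠ 0).image M.cross
  have hX₀ : ∀ e ∈ X₀, e ∈ M.support.edgeSet := by
    intro e he
    obtain ⟨e', -, rfl⟩ := Finset.mem_image.1 he
    rw [edgeSet_support]
    exact Or.inr ⟨e', rfl⟩
  have htrace : M.trace X₀ = z := by
    ext e
    have : M.cross e ∈ X₀ ↔ z e ≠ 0 := by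
      simp [X₀, M.cross_injective.eq_iff]
    have h01 : ∀ a : ZMod 2, (if a ≠ 0 then 1 else 0) = a := by decide
    simp only [trace, this, h01]
  obtain ⟨Y, hY, hb⟩ : boundary X₀ ∈ M.innerBoundaries := by
    refine M.mem_innerBoundaries (fun v hv => ?_) fun w => ?_
    · refine Finset.sum_eq_zero fun e he => if_neg fun hve => ?_
      obtain ⟨e', -, rfl⟩ := Finset.mem_image.1 he
      obtain ⟨w₁, w₂, x, y, -, -, hx, hy, hxy⟩ := M.cross_spec e'
      rw [hxy, Sym2.mem_iff] at hve
      rcases hve with rfl | rfl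
      exacts [hv _ hx, hv _ hy]
    · rw [M.sum_boundary hX₀, htrace, hz, Pi.zero_apply]
  refine ⟨symmDiff X₀ Y, ?_, ?_⟩
  · rw [isF2CycleIn_iff_boundary, boundary_symmDiff, hb]
    refine ⟨fun e he => ?_, add_self_eq_zero_of_zmod_two _⟩
    rcases Finset.mem_symmDiff.1 he with h | h
    · exact hX₀ e h.1
    · rw [edgeSet_support]
      exact Or.inl (hY e h.1)
  · have hY0 : M.trace Y = 0 := by
      ext e
      exact if_neg fun h => M.cross_notMem_inner e (hY _ h)
    rw [trace_symmDiff, htrace, hY0, add_zero]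

open scoped Classical in
theorem girth_le_of_trace_ne_zero [DecidableEq W] (M : MinorModel H G) {γ : ℕ}
    (hγ : ∀ Z, IsF2CycleIn H.edgeSet Z → Z.Nonempty → γ ≤ Z.card) {X : Finset (Sym2 V)}
    (hX : IsF2CycleIn M.support.edgeSet X) (h0 : M.trace X ≠ 0) :
    γ ≤ (Finset.univ.filter fun e => M.cross e ∈ X).card := by
  rw [← Finset.card_image_of_injective _ (Subtype.val_injective (p := (· ∈ H.edgeSet)))]
  refine hγ _ ((isF2CycleIn_iff_boundary _ _).2 ⟨?_, ?_⟩) ?_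
  · intro e he
    obtain ⟨e', -, rfl⟩ := Finset.mem_image.1 he
    exact e'.2
  · rw [isF2CycleIn_iff_boundary] at hX
    ext w
    have h := M.sum_boundary hX.1 w
    simp only [hX.2, Pi.zero_apply, Finset.sum_const_zero] at h
    rw [boundary, Finset.sum_image fun _ _ _ _ h => Subtype.ext h, Finset.sum_filter]
    refine Eq.trans ?_ h.symm
    refine Finset.sum_congr rfl fun e _ => ?_
    simp only [trace]
    split_ifs <;> rfl
  · obtain ⟨e, he⟩ := Function.ne_iff.1 h0
    refine Finset.image_nonempty.2 ⟨e, ?_⟩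
    simpa [trace] using he

open scoped Classical in
/-- The lower bound on the congestion of a generating family, for any graph having a minor whose
nonempty cycles have at least `γ` edges. -/
theorem girth_mul_card_le [DecidableEq W] (M : MinorModel H G) {γ b : ℕ}
    (hγ : ∀ Z, IsF2CycleIn H.edgeSet Z → Z.Nonempty → γ ≤ Z.card) (hb : M.support.bn ≤ b) :
    γ * H.edgeFinset.card ≤ b * H.edgeFinset.card + γ * Fintype.card W := by
  obtain ⟨B, hBcyc, hBgen, hBcong⟩ := exists_generating_of_bnSet_le hb
  set B' := B.filter fun X => M.trace X ≠ 0 with hB'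
  have hker : LinearMap.ker (incidenceMap H) ≤
      Submodule.span (ZMod 2) ((B'.map M.trace).toFinset : Set (H.edgeSet → ZMod 2)) := by
    intro z hz
    obtain ⟨X, hX, rfl⟩ := M.exists_lift hz
    obtain ⟨l, hl, rfl⟩ := hBgen X hX
    have hl' := hl.subset
    clear hz hX hl
    induction l with
    | nil =>
      have : M.trace ∅ = 0 := by ext; simp [trace]
      simp [this]
    | cons Y l ih =>
      rw [List.foldr_cons, trace_symmDiff]
      refine add_mem ?_ (ih fun Z hZ => hl' (List.mem_cons_of_mem _ hZ))
      by_cases hY : M.trace Y = 0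
      · rw [hY]; exact zero_mem _
      · refine Submodule.subset_span ?_
        simp only [List.coe_toFinset, List.mem_map, Set.mem_ofPred_eq]
        exact ⟨Y, by simpa [hB', hY] using hl' (by simp), rfl⟩
  have hfin : Module.finrank (ZMod 2) (LinearMap.ker (incidenceMap H)) ≤ B'.length := by
    refine (Submodule.finrank_mono hker).trans ((finrank_span_finset_le_card _).trans ?_)
    simpa using List.toFinset_card_le (B'.map M.trace)
  have hrank : Module.finrank (ZMod 2) (LinearMap.range (incidenceMap H)) ≤ Fintype.card W := by
    simpa using Submodule.finrank_le (LinearMap.range (incidenceMap H))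
  have hdim := LinearMap.finrank_range_add_finrank_ker (incidenceMap H)
  rw [Module.finrank_fintype_fun_eq_card, ← SimpleGraph.edgeFinset_card] at hdim
  have hlow : ∀ L : List (Finset (Sym2 V)), (∀ X ∈ L, IsF2CycleIn M.support.edgeSet X) →
      γ * (L.filter fun X => M.trace X ≠ 0).length ≤
        ∑ e : H.edgeSet, L.countP fun X => decide (M.cross e ∈ X) := by
    intro L hL
    induction L with
    | nil => simp
    | cons X L ih =>
      have ih := ih fun Y hY => hL Y (List.mem_cons_of_mem _ hY)
      have hX := hL X (by simp)
      simp only [List.countP_cons, Finset.sum_add_distrib, decide_eq_true_eq, Finset.sum_boole,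
        Nat.cast_id]
      by_cases h0 : M.trace X = 0
      · simp only [List.filter_cons, h0, ne_eq, not_true_eq_false, decide_false] at ih ⊢
        simp at ih ⊢
        omega
      · have := M.girth_le_of_trace_ne_zero hγ hX h0
        simp [h0] at ih ⊢
        rw [mul_add]
        omega
  have hup : ∑ e : H.edgeSet, (B.countP fun X => decide (M.cross e ∈ X)) ≤
      b * H.edgeFinset.card := by
    refine (Finset.sum_le_card_nsmul _ _ b fun e _ => hBcong _).trans ?_
    rw [Finset.card_univ, ← SimpleGraph.edgeFinset_card, smul_eq_mul, mul_comm]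
  calc γ * H.edgeFinset.card ≤ γ * (B'.length + Fintype.card W) :=
        Nat.mul_le_mul_left _ (by omega)
    _ ≤ _ := by rw [mul_add]; exact Nat.add_le_add_right ((hlow B hBcyc).trans hup) _

end MinorModel

/-- a monotone class of (finite) graphs with bounded basis number excludes
some graph as a minor. -/
theorem monotone_bounded_bn_excludes_minor
    (C : ∀ n : ℕ, Set (SimpleGraph (Fin n)))
    (hmono : ∀ (n m : ℕ) (G : SimpleGraph (Fin n)) (H : SimpleGraph (Fin m)),
      G ∈ C n → IsSubgraphOf H G → H ∈ C m)
    (b : ℕ) (hb : ∀ (n : ℕ), ∀ G ∈ C n, SimpleGraph.bn G ≤ b) :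
    ∃ (k : ℕ) (H : SimpleGraph (Fin k)), ∀ (n : ℕ), ∀ G ∈ C n, ¬ IsMinorOf H G := by
  classical
  obtain ⟨H, hgirth, hlow, hup⟩ := exists_sparse_large_girth (γ := 12 * b + 1) (by omega)
  refine ⟨_, H, fun n G hG hminor => ?_⟩
  obtain ⟨M⟩ := hminor.nonempty_minorModel
  have hsupp : M.support ∈ C n :=
    hmono n n G _ hG ⟨id, Function.injective_id, fun _ _ h => M.support_le h⟩
  have hmain := M.girth_mul_card_le hgirth (hb n _ hsupp)
  rw [Fintype.card_fin] at hmain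
  have h₁ := Nat.mul_le_mul_left (12 * b + 1) hlow
  have h₂ := Nat.mul_le_mul_left b hup
  have hpos : 0 < 4 ^ (12 * b + 1) := by positivity
  nlinarith
end

section
/- Let H be a connected hypergraph with designated distinct source s and sink t (a network), in which there are two edge-disjoint-on-non-cutedges s–t paths: precisely, there exist two s–t paths P_1, P_2 such that a hyperedge e is used by both P_1 and P_2 if and only if e is a cutedge (a hyperedge lying on every s–t path). -/
/-- A path in a hypergraph with vertex type `α` and hyperedges `E : ι → Set α`
(hyperedges are indexed, so multiplicities are allowed): an alternating sequence of
pairwise distinct vertices and pairwise distinct hyperedges, from `s` to `t`, each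
consecutive pair of vertices lying in the connecting hyperedge. -/
structure HPath {α ι : Type*} (E : ι → Set α) (s t : α) where
  verts : List α
  edges : List ι
  nodup_verts : verts.Nodup
  nodup_edges : edges.Nodup
  len : verts.length = edges.length + 1
  head : verts.head? = some s
  last : verts.getLast? = some t
  mem_left : ∀ i : Fin edges.length,
    verts.get ⟨i.1, by omega⟩ ∈ E (edges.get i)
  mem_right : ∀ i : Fin edges.length,
    verts.get ⟨i.1 + 1, by omega⟩ ∈ E (edges.get i)

/-- The hypergraph is connected: any two vertices are joined by a path. -/
def HConnected {α ι : Type*} (E : ι → Set α) : Prop :=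
  ∀ x y : α, Nonempty (HPath E x y)

/-- A cutedge of the network `(E, s, t)`: a hyperedge lying on every `s`–`t` path. -/
def IsCutedge {α ι : Type*} (E : ι → Set α) (s t : α) (e : ι) : Prop :=
  ∀ p : HPath E s t, e ∈ p.edges

/-- `ReachIn R A S v`: there is an `R`-walk from some vertex of `A` to `v` all of whose vertices
lie in `S`. -/
inductive ReachIn {V : Type*} (R : V → V → Prop) (A S : Set V) : V → Prop
  | start {a : V} (hA : a ∈ A) (hS : a ∈ S) : ReachIn R A S a
  | step {v w : V} (hv : ReachIn R A S v) (hR : R v w) (hS : w ∈ S) : ReachIn R A S w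

namespace ReachIn

variable {V : Type*} {R : V → V → Prop} {A S T : Set V} {v w x : V}

theorem mem (h : ReachIn R A S v) : v ∈ S := by
  cases h <;> assumption

theorem mono (hST : S ⊆ T) (h : ReachIn R A S v) : ReachIn R A T v := by
  induction h with
  | start hA hS => exact .start hA (hST hS)
  | step _ hR hS ih => exact .step ih hR (hST hS)

/-- A set through which `v` is reachable can be shrunk so that each of its other vertices is
reachable through it without passing `v`. -/
theorem exists_trimmed (h : ReachIn R A S v) :
    ∃ S' ⊆ S, ReachIn R A S' v ∧ ∀ x ∈ S', x ≠ v → ReachIn R A (S' \ {v}) x := by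
  have hsub : {x | ReachIn R A (S \ {v}) x} ⊆ S := fun x hx => hx.mem.1
  have trim : ∀ x, ReachIn R A (S \ {v}) x →
      ReachIn R A (insert v {x | ReachIn R A (S \ {v}) x} \ {v}) x := by
    intro x hx
    induction hx with
    | start hA hS => exact .start hA ⟨Or.inr (ReachIn.start hA hS), hS.2⟩
    | step hv hR hS ih => exact .step ih hR ⟨Or.inr (ReachIn.step hv hR hS), hS.2⟩
  have main : ∀ x, ReachIn R A S x → ReachIn R A (insert v {x | ReachIn R A (S \ {v}) x}) v ∨
      ReachIn R A (S \ {v}) x := by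
    intro x hx
    induction hx with
    | @start a hA hS =>
      by_cases hav : a = v
      · subst hav
        exact Or.inl (.start hA (Set.mem_insert _ _))
      · exact Or.inr (.start hA ⟨hS, hav⟩)
    | @step y z hy hR hS ih =>
      rcases ih with ih | ih
      · exact Or.inl ih
      by_cases hzv : z = v
      · subst hzv
        exact Or.inl (.step ((trim y ih).mono Set.sdiff_subset) hR (Set.mem_insert _ _))
      · exact Or.inr (.step ih hR ⟨hS, hzv⟩)
  refine ⟨insert v {x | ReachIn R A (S \ {v}) x}, Set.insert_subset h.mem hsub, ?_, ?_⟩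
  · exact (main v h).resolve_right fun h' => h'.mem.2 rfl
  · intro x hx hxv
    exact trim x (hx.resolve_left hxv)

/-- If every vertex of `S ∪ T` other than `v` is reachable inside `S` or `T` without passing `v`,
then a vertex reachable while avoiding `v` is reachable by a walk which first stays in one of `S`,
`T` and then outside both. -/
theorem avoid_or (hS : ∀ x ∈ S, x ≠ v → ReachIn R A (S \ {v}) x)
    (hT : ∀ x ∈ T, x ≠ v → ReachIn R A (T \ {v}) x) (h : ReachIn R A {v}ᶜ w) :
    ReachIn R A (S \ {v} ∪ (S ∪ T)ᶜ) w ∨ ReachIn R A (T \ {v} ∪ (S ∪ T)ᶜ) w := by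
  have key : ∀ z, z ≠ v → (z ∉ S → z ∉ T →
      ReachIn R A (S \ {v} ∪ (S ∪ T)ᶜ) z ∨ ReachIn R A (T \ {v} ∪ (S ∪ T)ᶜ) z) →
      ReachIn R A (S \ {v} ∪ (S ∪ T)ᶜ) z ∨ ReachIn R A (T \ {v} ∪ (S ∪ T)ᶜ) z := by
    intro z hz hout
    by_cases hzS : z ∈ S
    · exact Or.inl ((hS z hzS hz).mono Set.subset_union_left)
    by_cases hzT : z ∈ T
    · exact Or.inr ((hT z hzT hz).mono Set.subset_union_left)
    exact hout hzS hzT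
  induction h with
  | start hA hv => exact key _ hv fun h₁ h₂ => Or.inl (.start hA (Or.inr (by simp [h₁, h₂])))
  | step _ hR hv ih =>
    refine key _ hv fun h₁ h₂ => ?_
    exact ih.imp (fun h => .step h hR (Or.inr (by simp [h₁, h₂])))
      (fun h => .step h hR (Or.inr (by simp [h₁, h₂])))

/-- In a symmetric relation, a reachable vertex can be reached through two sets whose common
elements all separate it from `A`. -/
theorem exists_two (hsymm : ∀ x y, R x y → R y x) (h : ReachIn R A Set.univ v) :
    ∃ S T : Set V, ReachIn R A S v ∧ ReachIn R A T v ∧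
      ∀ x ∈ S, x ∈ T → ¬ ReachIn R A {x}ᶜ v := by
  induction h with
  | @start a hA _ =>
    refine ⟨{a}, {a}, .start hA rfl, .start hA rfl, ?_⟩
    rintro x rfl - h
    exact h.mem rfl
  | @step v w _ hR _ ih =>
    obtain ⟨S₀, T₀, hS₀, hT₀, hcut₀⟩ := ih
    obtain ⟨S, hSS, hS, hS'⟩ := hS₀.exists_trimmed
    obtain ⟨T, hTT, hT, hT'⟩ := hT₀.exists_trimmed
    have hcut : ∀ x ∈ S, x ∈ T → x ≠ v → ¬ ReachIn R A {x}ᶜ w := fun x hxS hxT hxv h =>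
      hcut₀ x (hSS hxS) (hTT hxT) (.step h (hsymm _ _ hR) hxv.symm)
    have hself : ¬ ReachIn R A {w}ᶜ w := fun h => h.mem rfl
    have extend : ∀ {U : Set V}, ReachIn R A U v → ReachIn R A (insert w U) w := fun hU =>
      .step (hU.mono (Set.subset_insert _ _)) hR (Set.mem_insert _ _)
    by_cases hvw : ReachIn R A {v}ᶜ w
    · rcases avoid_or hS' hT' hvw with h | h
      · refine ⟨_, _, h, extend hT, ?_⟩
        rintro x hx (rfl | hxT)
        · exact hself
        · rcases hx with hx | hx
          · exact hcut x hx.1 hxT hx.2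
          · exact absurd (Or.inr hxT) hx
      · refine ⟨_, _, h, extend hS, ?_⟩
        rintro x hx (rfl | hxS)
        · exact hself
        · rcases hx with hx | hx
          · exact hcut x hxS hx.1 hx.2
          · exact absurd (Or.inl hxS) hx
    · refine ⟨_, _, extend hS, extend hT, ?_⟩
      rintro x (rfl | hxS) hxT
      · exact hself
      rcases hxT with rfl | hxT
      · exact hself
      by_cases hxv : x = v
      · exact hxv ▸ hvw
      · exact hcut x hxS hxT hxv

end ReachIn

namespace HPath

variable {α ι : Type*} {E : ι → Set α} {s t u v : α}

/-- The path with no hyperedge. -/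
def nil (E : ι → Set α) (s : α) : HPath E s s where
  verts := [s]
  edges := []
  nodup_verts := by simp
  nodup_edges := by simp
  len := rfl
  head := rfl
  last := rfl
  mem_left := fun i => i.elim0
  mem_right := fun i => i.elim0

/-- The initial segment of a path with `i` hyperedges. -/
def take (p : HPath E s t) (i : ℕ) (hi : i < p.verts.length) : HPath E s p.verts[i] where
  verts := p.verts.take (i + 1)
  edges := p.edges.take i
  nodup_verts := p.nodup_verts.sublist (List.take_sublist _ _)
  nodup_edges := p.nodup_edges.sublist (List.take_sublist _ _)
  len := by
    have := p.len
    simp only [List.length_take]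
    omega
  head := by
    rw [List.head?_take, if_neg (by omega), p.head]
  last := by
    rw [List.getLast?_eq_getElem?, List.length_take, min_eq_left (by omega)]
    simp [hi]
  mem_left := fun j => by
    have hj : j.1 < p.edges.length := by have := j.2; simp at this; omega
    simpa using p.mem_left ⟨j.1, hj⟩
  mem_right := fun j => by
    have hj : j.1 < p.edges.length := by have := j.2; simp at this; omega
    simpa using p.mem_right ⟨j.1, hj⟩

/-- Extend a path by a new hyperedge and a new vertex. -/
def snoc (p : HPath E s u) (e : ι) (v : α) (he : e ∉ p.edges) (hv : v ∉ p.verts)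
    (hue : u ∈ E e) (hve : v ∈ E e) : HPath E s v where
  verts := p.verts ++ [v]
  edges := p.edges ++ [e]
  nodup_verts := by
    simpa [List.nodup_append, p.nodup_verts] using fun a (ha : a ∈ p.verts) (h : a = v) =>
      hv (h ▸ ha)
  nodup_edges := by
    simpa [List.nodup_append, p.nodup_edges] using fun a (ha : a ∈ p.edges) (h : a = e) =>
      he (h ▸ ha)
  len := by simp [p.len]
  head := by simp [List.head?_append, p.head]
  last := by simp
  mem_left := fun i => by
    have hi := i.2
    have hlen := p.len
    simp only [List.length_append, List.length_singleton] at hi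
    simp only [List.get_eq_getElem]
    rw [List.getElem_append_left (show i.1 < p.verts.length by omega)]
    by_cases h : i.1 < p.edges.length
    · rw [List.getElem_append_left h]
      exact p.mem_left ⟨i.1, h⟩
    · have hi' : i.1 = p.edges.length := by omega
      have hl := p.last
      rw [List.getLast?_eq_getElem?, p.len, Nat.add_sub_cancel] at hl
      obtain ⟨_, hl⟩ := List.getElem?_eq_some_iff.1 hl
      simpa [hi', hl] using hue
  mem_right := fun i => by
    have hi := i.2
    have hlen := p.len
    simp only [List.length_append, List.length_singleton] at hi
    simp only [List.get_eq_getElem]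
    by_cases h : i.1 < p.edges.length
    · rw [List.getElem_append_left h, List.getElem_append_left (by omega)]
      exact p.mem_right ⟨i.1, h⟩
    · have hi' : i.1 = p.edges.length := by omega
      simpa [hi', ← hlen] using hve

theorem exists_step (p : HPath E s u) {e : ι} (hue : u ∈ E e) (hve : v ∈ E e) :
    ∃ q : HPath E s v, ∀ f ∈ q.edges, f = e ∨ f ∈ p.edges := by
  have hlen := p.len
  by_cases hv : v ∈ p.verts
  · obtain ⟨i, hi, rfl⟩ := List.getElem_of_mem hv
    exact ⟨p.take i hi, fun f hf => Or.inr (List.mem_of_mem_take hf)⟩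
  by_cases he : e ∈ p.edges
  · obtain ⟨i, hi, rfl⟩ := List.getElem_of_mem he
    have hnot : p.edges[i] ∉ (p.take i (by omega)).edges := by
      intro h
      obtain ⟨j, hj, hji⟩ := List.mem_take_iff_getElem.1 h
      have := (p.nodup_edges.getElem_inj_iff).1 hji
      omega
    refine ⟨(p.take i (by omega)).snoc p.edges[i] v hnot
      (fun h => hv (List.mem_of_mem_take h)) (p.mem_left ⟨i, hi⟩) hve, fun f hf => ?_⟩
    rcases List.mem_append.1 hf with hf | hf
    · exact Or.inr (List.mem_of_mem_take hf)
    · exact Or.inl (List.mem_singleton.1 hf)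
  · refine ⟨p.snoc e v he hv hue hve, fun f hf => ?_⟩
    rcases List.mem_append.1 hf with hf | hf
    · exact Or.inr hf
    · exact Or.inl (List.mem_singleton.1 hf)

end HPath

/-- The hyperedges of a network together with an extra hyperedge `{t}`. -/
def withSink {α ι : Type*} (E : ι → Set α) (t : α) : Option ι → Set α
  | none => {t}
  | some e => E e

/-- Reachability of hyperedges (or of the sink, as `none`) from the source, where consecutive
hyperedges intersect. -/
abbrev EdgeReachIn {α ι : Type*} (E : ι → Set α) (s t : α) (S : Set (Option ι)) :
    Option ι → Prop :=
  ReachIn (fun x y => (withSink E t x ∩ withSink E t y).Nonempty) {x | s ∈ withSink E t x} S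

section

variable {α ι : Type*} {E : ι → Set α} {s t : α}

theorem EdgeReachIn.exists_path {S : Set (Option ι)} {x : Option ι} (h : EdgeReachIn E s t S x) :
    ∀ u ∈ withSink E t x, ∃ p : HPath E s u, ∀ e ∈ p.edges, some e ∈ S := by
  have key : ∀ {y : Option ι} {w u : α} (p : HPath E s w), (∀ e ∈ p.edges, some e ∈ S) → y ∈ S →
      w ∈ withSink E t y → u ∈ withSink E t y →
      ∃ q : HPath E s u, ∀ e ∈ q.edges, some e ∈ S := by
    rintro (_ | e) w u p hp hy hw hu
    · obtain rfl : w = t := hw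
      obtain rfl : u = w := hu
      exact ⟨p, hp⟩
    · obtain ⟨q, hq⟩ := p.exists_step hw hu
      refine ⟨q, fun f hf => ?_⟩
      rcases hq f hf with rfl | hf
      · exact hy
      · exact hp f hf
  induction h with
  | start hA hS => exact fun u hu => key (HPath.nil E s) (by simp [HPath.nil]) hS hA hu
  | step _ hR hS ih =>
    intro u hu
    obtain ⟨w, hw₁, hw₂⟩ := hR
    obtain ⟨p, hp⟩ := ih w hw₁
    exact key p hp hS hw₂ hu

theorem HPath.edgeReachIn (hst : s ≠ t) (p : HPath E s t) {S : Set (Option ι)}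
    (hS : ∀ e ∈ p.edges, some e ∈ S) (hnone : none ∈ S) : EdgeReachIn E s t S none := by
  have hlen := p.len
  have h0 : p.verts[0] = s := by
    have h := p.head
    rw [List.head?_eq_getElem?] at h
    exact (List.getElem?_eq_some_iff.1 h).2
  have hl : p.verts[p.edges.length] = t := by
    have h := p.last
    rw [List.getLast?_eq_getElem?, p.len, Nat.add_sub_cancel] at h
    exact (List.getElem?_eq_some_iff.1 h).2
  have hpos : 0 < p.edges.length := by
    rcases Nat.eq_zero_or_pos p.edges.length with h | h
    · simp only [h] at hl
      exact absurd (h0.symm.trans hl) hst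
    · exact h
  have reach : ∀ i (hi : i < p.edges.length), EdgeReachIn E s t S (some p.edges[i]) := by
    intro i
    induction i with
    | zero =>
      intro hi
      refine .start ?_ (hS _ (List.getElem_mem _))
      have := p.mem_left ⟨0, hi⟩
      simp only [List.get_eq_getElem, h0] at this
      exact this
    | succ i ih =>
      intro hi
      exact .step (ih (by omega)) ⟨_, p.mem_right ⟨i, by omega⟩, p.mem_left ⟨i + 1, hi⟩⟩
        (hS _ (List.getElem_mem _))
  refine .step (reach (p.edges.length - 1) (by omega)) ⟨t, ?_, rfl⟩ hnone
  have h := p.mem_right ⟨p.edges.length - 1, by omega⟩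
  simp only [List.get_eq_getElem, Nat.sub_add_cancel hpos, hl] at h
  exact h

end

/-- Menger-type: in a finite connected network with source `s` and sink
`t`, there are two `s`–`t` paths whose common hyperedges are exactly the cutedges. -/
theorem exists_two_paths_common_edges_eq_cutedges {α ι : Type*} [Fintype α] [Fintype ι]
    (E : ι → Set α) (s t : α) (hst : s ≠ t) (hconn : HConnected E) :
    ∃ p₁ p₂ : HPath E s t,
      ∀ e : ι, (e ∈ p₁.edges ∧ e ∈ p₂.edges) ↔ IsCutedge E s t e := by
  obtain ⟨p⟩ := hconn s t
  obtain ⟨S, T, hS, hT, hcut⟩ := ReachIn.exists_two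
    (fun x y h => by rwa [Set.inter_comm])
    (p.edgeReachIn hst (S := Set.univ) (fun _ _ => trivial) trivial)
  obtain ⟨p₁, h₁⟩ := EdgeReachIn.exists_path hS t rfl
  obtain ⟨p₂, h₂⟩ := EdgeReachIn.exists_path hT t rfl
  refine ⟨p₁, p₂, fun e => ⟨fun he q => ?_, fun he => ⟨he p₁, he p₂⟩⟩⟩
  by_contra hq
  refine hcut (some e) (h₁ e he.1) (h₂ e he.2) (q.edgeReachIn hst ?_ (by simp))
  intro f hf hfe
  exact hq (Option.some_inj.1 hfe ▸ hf)
end
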